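/- Let β > 0, d > n, 4/d ≤ α < 8/(d+n), and suppose 0 < b < c are such that m_b = 0 and m_b admits a minimizer u ∈ S(b). Then for every τ > b, m_τ < m_b = 0. (Consequently m_c cannot be zero and have a minimizer simultaneously on an interval where m ≡ 0.) -/

import Mathlib

noncomputable section

open MeasureTheory Real Filter Set

namespace BNLS

/-- A point of `ℝ^d × 𝕋^n`, the torus being modelled by periodic functions on `ℝ^n`. -/
abbrev Pt (d n : ℕ) := (Fin d → ℝ) × (Fin n → ℝ)

/-- Fundamental domain `[0,2π)^n` of the torus `(ℝ/2πℤ)^n`. -/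
def torusBox (n : ℕ) : Set (Fin n → ℝ) := Set.univ.pi fun _ => Set.Ico 0 (2*π)

/-- The measure of the torus `𝕋^n`. -/
def μT (n : ℕ) : Measure (Fin n → ℝ) := volume.restrict (torusBox n)

/-- The measure of `ℝ^d × 𝕋^n`. -/
def μP (d n : ℕ) : Measure (Pt d n) := (volume : Measure (Fin d → ℝ)).prod (μT n)

/-- Partial derivative in the `i`-th `x`-direction. -/
def dX (d n : ℕ) (i : Fin d) (u : Pt d n → ℂ) : Pt d n → ℂ :=
  fun p => fderiv ℝ u p (Pi.single i 1, 0)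

/-- Partial derivative in the `j`-th `y`-direction. -/
def dY (d n : ℕ) (j : Fin n) (u : Pt d n → ℂ) : Pt d n → ℂ :=
  fun p => fderiv ℝ u p (0, Pi.single j 1)

/-- Partial Laplacian `Δ_x`. -/
def lapX (d n : ℕ) (u : Pt d n → ℂ) : Pt d n → ℂ := fun p => ∑ i, dX d n i (dX d n i u) p

/-- Partial Laplacian `Δ_y`. -/
def lapY (d n : ℕ) (u : Pt d n → ℂ) : Pt d n → ℂ := fun p => ∑ j, dY d n j (dY d n j u) p

/-- Full Laplacian `Δ_{x,y}`. -/
def lap (d n : ℕ) (u : Pt d n → ℂ) : Pt d n → ℂ := fun p => lapX d n u p + lapY d n u p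

/-- Mass `‖u‖_{L²}²`. -/
def Mass (d n : ℕ) (u : Pt d n → ℂ) : ℝ := ∫ z, ‖u z‖^2 ∂(μP d n)

/-- `‖u‖_{L^p}^p`. -/
def Npow (d n : ℕ) (p : ℝ) (u : Pt d n → ℂ) : ℝ := ∫ z, ‖u z‖ ^ p ∂(μP d n)

/-- The `L^p` norm. -/
def LpN (d n : ℕ) (p : ℝ) (u : Pt d n → ℂ) : ℝ := (Npow d n p u) ^ (1/p)

/-- `‖Δ u‖_{L²}²`. -/
def lapSq (d n : ℕ) (u : Pt d n → ℂ) : ℝ := ∫ z, ‖lap d n u z‖^2 ∂(μP d n)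

/-- `‖Δ_x u‖_{L²}²`. -/
def lapXSq (d n : ℕ) (u : Pt d n → ℂ) : ℝ := ∫ z, ‖lapX d n u z‖^2 ∂(μP d n)

/-- `‖Δ_y u‖_{L²}²`. -/
def lapYSq (d n : ℕ) (u : Pt d n → ℂ) : ℝ := ∫ z, ‖lapY d n u z‖^2 ∂(μP d n)

/-- `‖∇_x u‖_{L²}²`. -/
def gradXSq (d n : ℕ) (u : Pt d n → ℂ) : ℝ := ∫ z, (∑ i, ‖dX d n i u z‖^2) ∂(μP d n)

/-- `‖∇_y u‖_{L²}²`. -/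
def gradYSq (d n : ℕ) (u : Pt d n → ℂ) : ℝ := ∫ z, (∑ j, ‖dY d n j u z‖^2) ∂(μP d n)

/-- `‖∇ u‖_{L²}²`. -/
def gradSq (d n : ℕ) (u : Pt d n → ℂ) : ℝ := gradXSq d n u + gradYSq d n u

/-- Pointwise sum of squares of all second derivatives. -/
def hessInt (d n : ℕ) (u : Pt d n → ℂ) (z : Pt d n) : ℝ :=
  (∑ i, ∑ i', ‖dX d n i (dX d n i' u) z‖^2) + (∑ i, ∑ j, ‖dY d n j (dX d n i u) z‖^2)
  + (∑ j, ∑ i, ‖dX d n i (dY d n j u) z‖^2) + (∑ j, ∑ j', ‖dY d n j (dY d n j' u) z‖^2)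

/-- `‖∇² u‖_{L²}²`. -/
def hessSq (d n : ℕ) (u : Pt d n → ℂ) : ℝ := ∫ z, hessInt d n u z ∂(μP d n)

/-- The `H²` norm on `ℝ^d × 𝕋^n`. -/
def H2norm (d n : ℕ) (u : Pt d n → ℂ) : ℝ :=
  Real.sqrt (Mass d n u + gradSq d n u + hessSq d n u)

/-- `2π`-periodicity in all `y`-variables. -/
def Periodic (d n : ℕ) (u : Pt d n → ℂ) : Prop :=
  ∀ j : Fin n, ∀ p : Pt d n, u (p.1, p.2 + (2*π) • (Pi.single j 1 : Fin n → ℝ)) = u p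

/-- Membership in `H²(ℝ^d × 𝕋^n)`. -/
def InH2 (d n : ℕ) (u : Pt d n → ℂ) : Prop :=
  ContDiff ℝ 2 u ∧ Periodic d n u ∧
  Integrable (fun z => ‖u z‖^2) (μP d n) ∧
  Integrable (fun z => (∑ i, ‖dX d n i u z‖^2) + ∑ j, ‖dY d n j u z‖^2) (μP d n) ∧
  Integrable (hessInt d n u) (μP d n)

/-- The mass sphere `S(c)`. -/
def Sset (d n : ℕ) (c : ℝ) : Set (Pt d n → ℂ) := {u | InH2 d n u ∧ Mass d n u = c}

/-- The energy functional `E`. -/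
def En (d n : ℕ) (β α : ℝ) (u : Pt d n → ℂ) : ℝ :=
  (1/2) * lapSq d n u + (β/2) * gradSq d n u - (1/(α+2)) * Npow d n (α+2) u

/-- The ground state energy `m_c`. -/
def mC (d n : ℕ) (β α c : ℝ) : ℝ := sInf (En d n β α '' Sset d n c)

end BNLS

namespace BNLS

section core
set_option linter.unusedSectionVars false
variable {E : Type*} [NormedAddCommGroup E] [NormedSpace ℝ E] 

lemma core_lineV {a : ℝ} {η : E → ℝ} {u : E → ℂ} {x e : E} {η' : ℝ} {g : ℂ}
    (hη : HasLineDerivAt ℝ η η' x e) (hu : HasLineDerivAt ℝ u g x e) :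
    HasLineDerivAt ℝ (fun x => (η x ^ 2 * (1 + ‖u x‖^2) ^ (a/2)) • u x)
      ((η x ^ 2 * (1 + ‖u x‖^2) ^ (a/2)) • g +
        (2 * η x * η' * (1 + ‖u x‖^2) ^ (a/2)
          + η x ^ 2 * (2 * inner ℝ (u x) g * (a/2) * (1 + ‖u x‖^2) ^ (a/2 - 1))) • u x) x e := by
  unfold HasLineDerivAt at *
  have h1 := hu.norm_sq.const_add 1
  have h2 := h1.rpow_const (p := a/2) (Or.inl (by positivity))
  have h3 := ((hη.pow 2).mul h2).smul hu
  refine h3.congr_deriv ?_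
  simp only [Pi.mul_apply, Pi.pow_apply, zero_smul, add_zero, Nat.cast_ofNat,
    Nat.add_one_sub_one, pow_one, Nat.reduceSub]

lemma core_lineG {a : ℝ} {η : E → ℝ} {u v : E → ℂ} {x e : E} {η' : ℝ} {g g' : ℂ}
    (hη : HasLineDerivAt ℝ η η' x e) (hu : HasLineDerivAt ℝ u g x e)
    (hv : HasLineDerivAt ℝ v g' x e) :
    HasLineDerivAt ℝ (fun x => (η x ^ 4 * (1 + ‖u x‖^2) ^ a) * inner ℝ (u x) (v x))
      ((4 * η x ^ 3 * η' * (1 + ‖u x‖^2) ^ a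
          + η x ^ 4 * (2 * inner ℝ (u x) g * a * (1 + ‖u x‖^2) ^ (a - 1))) * inner ℝ (u x) (v x)
        + (η x ^ 4 * (1 + ‖u x‖^2) ^ a) * (inner ℝ (u x) g' + inner ℝ g (v x))) x e := by
  unfold HasLineDerivAt at *
  have h1 := hu.norm_sq.const_add 1
  have h2 := h1.rpow_const (p := a) (Or.inl (by positivity))
  have h3 := ((hη.pow 4).mul h2).mul (hu.inner ℝ hv)
  refine h3.congr_deriv ?_
  simp only [Pi.mul_apply, Pi.pow_apply, zero_smul, add_zero, Nat.cast_ofNat,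
    Nat.add_one_sub_one, pow_one, Nat.reduceSub]

lemma core_alg {a η η' K : ℝ} {u g g' : ℂ} (ha : 0 ≤ a) (ha1 : a ≤ 1) (hη : 0 ≤ η)
    (hK : |η'| ≤ K) :
    ‖(η ^ 2 * (1 + ‖u‖^2) ^ (a/2)) • g +
        (2 * η * η' * (1 + ‖u‖^2) ^ (a/2)
          + η ^ 2 * (2 * inner ℝ u g * (a/2) * (1 + ‖u‖^2) ^ (a/2 - 1))) • u‖ ^ 2
    ≤ 8 * ((4 * η ^ 3 * η' * (1 + ‖u‖^2) ^ a
          + η ^ 4 * (2 * inner ℝ u g * a * (1 + ‖u‖^2) ^ (a - 1))) * inner ℝ u g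
        + (η ^ 4 * (1 + ‖u‖^2) ^ a) * (inner ℝ u g' + inner ℝ g g))
      - 8 * (η ^ 4 * (1 + ‖u‖^2) ^ a) * inner ℝ u g'
      + 32 * η ^ 3 * K * (1 + ‖u‖^2) ^ a * ‖u‖ * ‖g‖
      + 8 * K^2 * η^2 * (1 + ‖u‖^2) ^ a * ‖u‖^2 := by
  have hs : 0 < 1 + ‖u‖^2 := by positivity
  have hK0 : 0 ≤ K := (abs_nonneg _).trans hK
  set P := (1 + ‖u‖^2) ^ (a/2) with hP
  have hP0 : 0 < P := by positivity
  have hQ : (1 + ‖u‖^2) ^ a = P ^ 2 := by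
    rw [hP, ← Real.rpow_mul_natCast hs.le]; norm_num
  have hP1 : (1 + ‖u‖^2) ^ (a/2 - 1) * ‖u‖^2 ≤ P := by
    rw [Real.rpow_sub_one hs.ne', ← hP, div_mul_eq_mul_div, div_le_iff₀ hs]
    nlinarith
  have hQ1 : 0 ≤ (1 + ‖u‖^2) ^ (a - 1) := by positivity
  have hR1 : 0 ≤ (1 + ‖u‖^2) ^ (a/2 - 1) := by positivity
  rw [hQ]
  set R := (1 + ‖u‖^2) ^ (a/2 - 1)
  set T := (1 + ‖u‖^2) ^ (a - 1)
  have hin : |inner ℝ u g| ≤ ‖u‖ * ‖g‖ := abs_real_inner_le_norm u g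
  rw [real_inner_self_eq_norm_sq g]
  set I := inner ℝ u g
  set U := ‖u‖
  set G := ‖g‖
  have hU : 0 ≤ U := norm_nonneg _
  have hG : 0 ≤ G := norm_nonneg _
  have hn : ‖(η ^ 2 * P) • g + (2 * η * η' * P + η ^ 2 * (2 * I * (a/2) * R)) • u‖
      ≤ 2 * P * (η * K * U + η^2 * G) := by
    refine (norm_add_le _ _).trans ?_
    rw [norm_smul, norm_smul, Real.norm_eq_abs, Real.norm_eq_abs, abs_of_nonneg (by positivity)]
    have h1 : |2 * η * η' * P + η ^ 2 * (2 * I * (a/2) * R)| ≤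
        2 * η * K * P + η^2 * (U * G * R) := by
      refine (abs_add_le _ _).trans (add_le_add ?_ ?_)
      · rw [abs_mul, abs_mul, abs_of_nonneg hP0.le, abs_of_nonneg (by positivity : 0 ≤ 2 * η)]
        gcongr
      · rw [abs_mul, abs_of_nonneg (by positivity : 0 ≤ η^2)]
        gcongr
        rw [abs_mul, abs_of_nonneg hR1]
        gcongr
        rw [abs_mul, abs_mul, abs_of_nonneg (by positivity : 0 ≤ a/2), abs_two]
        nlinarith [abs_nonneg I]
    have h2 := mul_le_mul_of_nonneg_right h1 hU
    have h3 : η^2 * (U * G * R) * U ≤ η^2 * G * P := by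
      have := mul_le_mul_of_nonneg_left hP1 (by positivity : 0 ≤ η^2 * G)
      nlinarith
    change _ * G + _ * U ≤ _
    nlinarith
  have hn2 := pow_le_pow_left₀ (norm_nonneg _) hn 2
  refine hn2.trans ?_
  have e1 : -(4 * η^3 * K * P^2 * (U * G)) ≤ 4 * η^3 * η' * P^2 * I := by
    have : |4 * η^3 * η' * P^2 * I| ≤ 4 * η^3 * K * P^2 * (U * G) := by
      rw [abs_mul, abs_mul, abs_mul, abs_of_nonneg (by positivity : 0 ≤ P^2),
        abs_of_nonneg (by positivity : 0 ≤ 4 * η^3)]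
      gcongr
    exact (abs_le.mp this).1
  have e2 : 0 ≤ η^4 * (2 * I * a * T) * I := by
    have : η^4 * (2 * I * a * T) * I = η^4 * 2 * a * T * I^2 := by ring
    rw [this]; positivity
  have e3 : (2 * P * (η * K * U + η^2 * G))^2 ≤ 8 * P^2 * ((η * K * U)^2 + (η^2*G)^2) := by
    nlinarith [mul_nonneg (sq_nonneg P) (sq_nonneg (η * K * U - η^2*G))]
  nlinarith

variable [MeasurableSpace E] [BorelSpace E] [FiniteDimensional ℝ E] (μ : Measure E)
  [μ.IsAddHaarMeasure]

lemma core_div {G : E → ℝ} (hG : ContDiff ℝ 1 G) (hc : HasCompactSupport G) (e : E) :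
    ∫ x, fderiv ℝ G x e ∂μ = 0 := by
  have h := integral_mul_fderiv_eq_neg_fderiv_mul_of_integrable (μ := μ) (f := fun _ : E => (1:ℝ))
    (g := G) (v := e) (by simp)
    (by
      simp only [one_mul]
      refine Continuous.integrable_of_hasCompactSupport ?_ (hc.fderiv_apply ℝ e)
      have := hG.continuous_fderiv (by norm_num)
      fun_prop)
    (by simpa using hG.continuous.integrable_of_hasCompactSupport hc)
    (by simp) (fun x _ => hG.differentiable (by norm_num) x)
  simpa using h

lemma core_int {S : Set E} (hS : IsCompact S) {f : E → ℝ} (hf : Continuous f) :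
    Integrable f (μ.restrict S) := hf.continuousOn.integrableOn_compact hS

lemma core_memLp {S : Set E} (hS : IsCompact S) {f : E → ℝ} (hf : Continuous f) (p : ENNReal) :
    MemLp f p (μ.restrict S) := by
  have : IsFiniteMeasure (μ.restrict S) := ⟨by simpa using hS.measure_lt_top⟩
  obtain ⟨C, hC⟩ := hS.exists_bound_of_continuousOn hf.continuousOn
  exact MemLp.of_bound hf.aestronglyMeasurable C
    ((ae_restrict_iff' hS.measurableSet).2 (Eventually.of_forall hC))

lemma core_cs {S : Set E} (hS : IsCompact S) {f h : E → ℝ} (hf : Continuous f) (hh : Continuous h)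
    (hf0 : ∀ x, 0 ≤ f x) (hh0 : ∀ x, 0 ≤ h x) :
    ∫ x in S, f x * h x ∂μ ≤ √(∫ x in S, f x ^ 2 ∂μ) * √(∫ x in S, h x ^ 2 ∂μ) := by
  have := integral_mul_le_Lp_mul_Lq_of_nonneg (μ := μ.restrict S) Real.HolderConjugate.two_two
    (Eventually.of_forall hf0) (Eventually.of_forall hh0) (core_memLp μ hS hf _)
    (core_memLp μ hS hh _)
  simpa [Real.sqrt_eq_rpow] using this

end core
end BNLS

namespace BNLS

section core2
set_option linter.unusedSectionVars false
variable {E : Type*} [NormedAddCommGroup E] [NormedSpace ℝ E] 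
variable [MeasurableSpace E] [BorelSpace E] [FiniteDimensional ℝ E] (μ : Measure E)
  [μ.IsAddHaarMeasure]

lemma core_sob (hD : 3 ≤ Module.finrank ℝ E) : ∃ C : ℝ, 0 ≤ C ∧ ∀ v : E → ℂ, ContDiff ℝ 1 v →
    HasCompactSupport v →
    (∫ x, ‖v x‖ ^ (2 * (Module.finrank ℝ E : ℝ) / (Module.finrank ℝ E - 2)) ∂μ) ^
      (((Module.finrank ℝ E : ℝ) - 2) / Module.finrank ℝ E) ≤ C * ∫ x, ‖fderiv ℝ v x‖^2 ∂μ := by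
  set D := Module.finrank ℝ E
  have hD' : (3:ℝ) ≤ D := by exact_mod_cast hD
  have hD2 : (0:ℝ) < D - 2 := by linarith
  refine ⟨(eLpNormLESNormFDerivOfEqInnerConst μ 2 : ℝ)^2, by positivity, fun v hv hc => ?_⟩
  set r : ℝ := 2 * D / (D - 2) with hr
  have hr0 : 0 < r := by positivity
  have h := eLpNorm_le_eLpNorm_fderiv_of_eq_inner μ hv hc (p := 2) (p' := r.toNNReal)
    (by norm_num) (by omega) (by
      change _ = _ - (D:ℝ)⁻¹
      rw [Real.coe_toNNReal _ hr0.le, hr]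
      simp only [NNReal.coe_inv, NNReal.coe_ofNat]
      field_simp)
  have hvm : MemLp v (r.toNNReal : ENNReal) μ := hv.continuous.memLp_of_hasCompactSupport hc
  have hfm : MemLp (fderiv ℝ v) ((2 : NNReal) : ENNReal) μ :=
    (hv.continuous_fderiv (by norm_num)).memLp_of_hasCompactSupport (hc.fderiv ℝ)
  rw [hvm.eLpNorm_eq_integral_rpow_norm (by simpa using hr0) (by simp),
    hfm.eLpNorm_eq_integral_rpow_norm (by simp) (by simp)] at h
  simp only [ENNReal.coe_toReal, Real.coe_toNNReal _ hr0.le, NNReal.coe_ofNat] at h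
  rw [← ENNReal.ofReal_coe_nnreal, ← ENNReal.ofReal_mul (by positivity),
    ENNReal.ofReal_le_ofReal_iff (by positivity)] at h
  have hI : 0 ≤ ∫ x, ‖v x‖ ^ r ∂μ := integral_nonneg fun x => by positivity
  have hJ : 0 ≤ ∫ x, ‖fderiv ℝ v x‖ ^ 2 ∂μ := integral_nonneg fun x => by positivity
  have h2 := pow_le_pow_left₀ (by positivity) h 2
  rw [← Real.rpow_mul_natCast hI] at h2
  have : r⁻¹ * (2:ℕ) = (D - 2) / D := by rw [hr]; push_cast; field_simp
  rw [this] at h2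
  refine h2.trans (le_of_eq ?_)
  have h3 : ∀ x, ‖fderiv ℝ v x‖ ^ (2:ℝ) = ‖fderiv ℝ v x‖ ^ 2 := fun x => Real.rpow_two _
  simp only [h3]
  rw [mul_pow, ← Real.rpow_mul_natCast hJ]
  norm_num

variable {ι : Type*} [Fintype ι] (e : ι → E)

/-- Density used in the local estimate. -/
noncomputable def FF (u : E → ℂ) (x : E) : ℝ :=
  ‖u x‖^2 + (∑ i, ‖fderiv ℝ u x (e i)‖^2) +
    ‖∑ i, fderiv ℝ (fun y => fderiv ℝ u y (e i)) x (e i)‖^2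

lemma contDiff_d {u : E → ℂ} (hu : ContDiff ℝ 2 u) (w : E) :
    ContDiff ℝ 1 (fun y => fderiv ℝ u y w) :=
  (hu.fderiv_right (m := 1) (by norm_num)).clm_apply contDiff_const

lemma cont_d {u : E → ℂ} (hu : ContDiff ℝ 1 u) (w : E) :
    Continuous (fun y => fderiv ℝ u y w) :=
  (hu.continuous_fderiv (by norm_num)).clm_apply continuous_const

lemma cont_FF {u : E → ℂ} (hu : ContDiff ℝ 2 u) : Continuous (FF e u) := by
  unfold FF
  have h0 := hu.continuous
  have h1 := fun i => (contDiff_d hu (e i)).continuous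
  have h2 := fun i => cont_d (contDiff_d hu (e i)) (e i)
  fun_prop

lemma core_pt {a K : ℝ} (ha : 0 ≤ a) (ha1 : a ≤ 1) {u : E → ℂ} (hu : ContDiff ℝ 2 u)
    {η : E → ℝ} (hη : ContDiff ℝ 1 η) (h0 : ∀ x, 0 ≤ η x) (h1 : ∀ x, η x ≤ 1)
    (hK0 : 0 ≤ K) (hK : ∀ x i, |fderiv ℝ η x (e i)| ≤ K) (x : E) :
    ∑ i, ‖fderiv ℝ (fun x => (η x ^ 2 * (1 + ‖u x‖^2) ^ (a/2)) • u x) x (e i)‖^2 ≤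
    8 * (∑ i, fderiv ℝ (fun x => (η x ^ 4 * (1 + ‖u x‖^2) ^ a) *
        inner ℝ (u x) (fderiv ℝ u x (e i))) x (e i)) +
    (η x ^ 2 * (1 + ‖u x‖^2) ^ a * ‖u x‖) *
      (8 * ‖∑ i, fderiv ℝ (fun y => fderiv ℝ u y (e i)) x (e i)‖
        + 32 * K * (∑ i, ‖fderiv ℝ u x (e i)‖) + 8 * Fintype.card ι * K^2 * ‖u x‖) := by
  have hs : ∀ x, 1 + ‖u x‖^2 ≠ 0 := fun x => by positivity
  have hu1 : ContDiff ℝ 1 u := hu.of_le (by norm_num)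
  have hρ : ∀ b : ℝ, ContDiff ℝ 1 (fun x => (1 + ‖u x‖^2) ^ b) := fun b =>
    (contDiff_const.add (hu1.norm_sq ℝ)).rpow_const_of_ne hs
  have hlu : ∀ i, HasLineDerivAt ℝ u (fderiv ℝ u x (e i)) x (e i) := fun i =>
    ((hu1.differentiable (by norm_num) x).hasFDerivAt).hasLineDerivAt _
  have hlη : ∀ i, HasLineDerivAt ℝ η (fderiv ℝ η x (e i)) x (e i) := fun i =>
    ((hη.differentiable (by norm_num) x).hasFDerivAt).hasLineDerivAt _
  have hld : ∀ i, HasLineDerivAt ℝ (fun y => fderiv ℝ u y (e i))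
      (fderiv ℝ (fun y => fderiv ℝ u y (e i)) x (e i)) x (e i) := fun i =>
    (((contDiff_d hu (e i)).differentiable (by norm_num) x).hasFDerivAt).hasLineDerivAt _
  have hV : ContDiff ℝ 1 (fun x => (η x ^ 2 * (1 + ‖u x‖^2) ^ (a/2)) • u x) :=
    ((hη.pow 2).mul (hρ _)).smul hu1
  have hG : ∀ i, ContDiff ℝ 1 (fun x => (η x ^ 4 * (1 + ‖u x‖^2) ^ a) *
        inner ℝ (u x) (fderiv ℝ u x (e i))) := fun i =>
    ((hη.pow 4).mul (hρ _)).mul (hu1.inner ℝ (contDiff_d hu (e i)))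
  have eV := fun i => (((hV.differentiable (by norm_num) x).hasFDerivAt).hasLineDerivAt
    (e i)).unique (core_lineV (a := a) (hlη i) (hlu i))
  have eG := fun i => ((((hG i).differentiable (by norm_num) x).hasFDerivAt).hasLineDerivAt
    (e i)).unique (core_lineG (a := a) (hlη i) (hlu i) (hld i))
  have hsum := Finset.sum_le_sum (s := Finset.univ) fun i _ =>
    core_alg (u := u x) (g := fderiv ℝ u x (e i))
      (g' := fderiv ℝ (fun y => fderiv ℝ u y (e i)) x (e i)) ha ha1 (h0 x) (hK x i)
  simp only [← eV, ← eG] at hsum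
  refine hsum.trans ?_
  simp only [Finset.sum_add_distrib, Finset.sum_sub_distrib, ← Finset.mul_sum, ← inner_sum]
  simp only [Finset.sum_const, Finset.card_univ, nsmul_eq_mul]
  set Q := (1 + ‖u x‖^2) ^ a
  have hQ : 0 ≤ Q := by positivity
  set L := ∑ i, fderiv ℝ (fun y => fderiv ℝ u y (e i)) x (e i)
  set B := ∑ i, ‖fderiv ℝ u x (e i)‖
  have hB : 0 ≤ B := Finset.sum_nonneg fun i _ => norm_nonneg _
  have hi : -(inner ℝ (u x) L) ≤ ‖u x‖ * ‖L‖ :=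
    (neg_le_abs _).trans (abs_real_inner_le_norm _ _)
  have hη4 : η x ^ 4 ≤ η x ^ 2 := pow_le_pow_of_le_one (h0 x) (h1 x) (by norm_num)
  have hη3 : η x ^ 3 ≤ η x ^ 2 := pow_le_pow_of_le_one (h0 x) (h1 x) (by norm_num)
  have hηx := h0 x
  have t1 : -(8 * (η x ^ 4 * Q) * inner ℝ (u x) L) ≤ 8 * (η x ^ 2 * Q) * (‖u x‖ * ‖L‖) := by
    calc _ = 8 * (η x ^ 4 * Q) * (-(inner ℝ (u x) L)) := by ring
      _ ≤ 8 * (η x ^ 4 * Q) * (‖u x‖ * ‖L‖) := by gcongr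
      _ ≤ _ := by gcongr
  have t2 : 32 * η x ^ 3 * K * Q * ‖u x‖ * B ≤ 32 * η x ^ 2 * K * Q * ‖u x‖ * B := by gcongr
  nlinarith

end core2
end BNLS

namespace BNLS

section core3
set_option linter.unusedSectionVars false
variable {E : Type*} [NormedAddCommGroup E] [NormedSpace ℝ E] 
variable [MeasurableSpace E] [BorelSpace E] [FiniteDimensional ℝ E] (μ : Measure E)
  [μ.IsAddHaarMeasure]
variable {ι : Type*} [Fintype ι] (e : ι → E)

lemma core_H {K A B U N S2 : ℝ} (hN : 0 ≤ N) (hB : B^2 ≤ N * S2) (hS2 : 0 ≤ S2) :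
    (8 * A + 32 * K * B + 8 * N * K^2 * U)^2 ≤
      (192 + 3072 * K^2 * N + 192 * N^2 * K^4) * (U^2 + S2 + A^2) := by
  have h1 : (8 * A + 32 * K * B + 8 * N * K^2 * U)^2 ≤
    3 * ((8*A)^2 + (32*K*B)^2 + (8*N*K^2*U)^2) := by
    nlinarith [sq_nonneg (8*A - 32*K*B), sq_nonneg (8*A - 8*N*K^2*U),
      sq_nonneg (32*K*B - 8*N*K^2*U)]
  refine h1.trans ?_
  have h2 : K^2 * B^2 ≤ K^2 * (N * S2) := by gcongr
  have : 0 ≤ K^2*N*U^2 := by positivity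
  have : 0 ≤ K^2*N*A^2 := by positivity
  have : 0 ≤ N^2*K^4*S2 := by positivity
  have : 0 ≤ N^2*K^4*A^2 := by positivity
  nlinarith [sq_nonneg U]

lemma core_grad {a K : ℝ} (ha : 0 ≤ a) (ha1 : a ≤ 1) {u : E → ℂ} (hu : ContDiff ℝ 2 u)
    {η : E → ℝ} (hη : ContDiff ℝ 1 η) (hc : HasCompactSupport η)
    (h0 : ∀ x, 0 ≤ η x) (h1 : ∀ x, η x ≤ 1)
    (hK0 : 0 ≤ K) (hK : ∀ x i, |fderiv ℝ η x (e i)| ≤ K) :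
    ∫ x in tsupport η,
      ∑ i, ‖fderiv ℝ (fun x => (η x ^ 2 * (1 + ‖u x‖^2) ^ (a/2)) • u x) x (e i)‖^2 ∂μ ≤
    √(∫ x in tsupport η, (η x ^ 2 * (1 + ‖u x‖^2) ^ a * ‖u x‖)^2 ∂μ) *
      √((192 + 3072 * K^2 * Fintype.card ι + 192 * (Fintype.card ι : ℝ)^2 * K^4) *
        ∫ x in tsupport η, FF e u x ∂μ) := by
  have hS : IsCompact (tsupport η) := hc
  have hs : ∀ x, 1 + ‖u x‖^2 ≠ 0 := fun x => by positivity
  have hu1 : ContDiff ℝ 1 u := hu.of_le (by norm_num)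
  have hρ : ∀ b : ℝ, ContDiff ℝ 1 (fun x => (1 + ‖u x‖^2) ^ b) := fun b =>
    (contDiff_const.add (hu1.norm_sq ℝ)).rpow_const_of_ne hs
  have hV : ContDiff ℝ 1 (fun x => (η x ^ 2 * (1 + ‖u x‖^2) ^ (a/2)) • u x) :=
    ((hη.pow 2).mul (hρ _)).smul hu1
  have hG : ∀ i, ContDiff ℝ 1 (fun x => (η x ^ 4 * (1 + ‖u x‖^2) ^ a) *
        inner ℝ (u x) (fderiv ℝ u x (e i))) := fun i =>
    ((hη.pow 4).mul (hρ _)).mul (hu1.inner ℝ (contDiff_d hu (e i)))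
  have hGs : ∀ i, Function.support (fun x => (η x ^ 4 * (1 + ‖u x‖^2) ^ a) *
        inner ℝ (u x) (fderiv ℝ u x (e i))) ⊆ Function.support η := fun i x hx h => by
    simp only [Function.mem_support] at hx
    exact hx (by rw [h]; ring)
  have hGc : ∀ i, HasCompactSupport (fun x => (η x ^ 4 * (1 + ‖u x‖^2) ^ a) *
        inner ℝ (u x) (fderiv ℝ u x (e i))) := fun i =>
    hc.mono (hGs i)
  have hcG : ∀ i, Continuous (fun x => fderiv ℝ (fun x => (η x ^ 4 * (1 + ‖u x‖^2) ^ a) *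
        inner ℝ (u x) (fderiv ℝ u x (e i))) x (e i)) := fun i =>
    ((hG i).continuous_fderiv (by norm_num)).clm_apply continuous_const
  have hdiv : ∫ x in tsupport η, ∑ i, fderiv ℝ (fun x => (η x ^ 4 * (1 + ‖u x‖^2) ^ a) *
        inner ℝ (u x) (fderiv ℝ u x (e i))) x (e i) ∂μ = 0 := by
    rw [integral_finsetSum _ fun i _ => core_int μ hS (hcG i)]
    refine Finset.sum_eq_zero fun i _ => ?_
    rw [setIntegral_eq_integral_of_forall_compl_eq_zero, core_div μ (hG i) (hGc i)]
    intro x hx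
    have : fderiv ℝ (fun x => (η x ^ 4 * (1 + ‖u x‖^2) ^ a) *
        inner ℝ (u x) (fderiv ℝ u x (e i))) x = 0 := by
      by_contra h
      exact hx (closure_mono (hGs i) (support_fderiv_subset ℝ h))
    rw [this]; rfl
  have cu := hu.continuous
  have c1 := fun i => (contDiff_d hu (e i)).continuous
  have c2 := fun i => cont_d (contDiff_d hu (e i)) (e i)
  have cη := hη.continuous
  have cρ := (hρ a).continuous
  have cV := fun i => cont_d hV (e i)
  have cf : Continuous (fun x => η x ^ 2 * (1 + ‖u x‖^2) ^ a * ‖u x‖) :=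
    ((cη.pow 2).mul cρ).mul cu.norm
  have cH : Continuous (fun x => 8 * ‖∑ i, fderiv ℝ (fun y => fderiv ℝ u y (e i)) x (e i)‖
        + 32 * K * (∑ i, ‖fderiv ℝ u x (e i)‖) + 8 * Fintype.card ι * K^2 * ‖u x‖) := by
    fun_prop
  have cSG : Continuous (fun x => ∑ i, fderiv ℝ (fun x => (η x ^ 4 * (1 + ‖u x‖^2) ^ a) *
        inner ℝ (u x) (fderiv ℝ u x (e i))) x (e i)) := continuous_finsetSum _ fun i _ => hcG i
  have cSV : Continuous (fun x =>
      ∑ i, ‖fderiv ℝ (fun x => (η x ^ 2 * (1 + ‖u x‖^2) ^ (a/2)) • u x) x (e i)‖^2) :=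
    continuous_finsetSum _ fun i _ => (cV i).norm.pow 2
  have hmono := integral_mono (μ := μ.restrict (tsupport η)) (core_int μ hS cSV)
    (((core_int μ hS cSG).const_mul 8).add (core_int μ hS (cf.mul cH)))
    (fun x => core_pt e ha ha1 hu hη h0 h1 hK0 hK x)
  refine hmono.trans ?_
  have hadd := integral_add (μ := μ.restrict (tsupport η)) ((core_int μ hS cSG).const_mul 8)
    (core_int μ hS (cf.mul cH))
  simp only [Pi.add_apply]
  rw [hadd, integral_const_mul, hdiv, mul_zero, zero_add]
  refine (core_cs μ hS cf cH (fun x => ?_) (fun x => ?_)).trans ?_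
  · have := h0 x; positivity
  · have : 0 ≤ ∑ i, ‖fderiv ℝ u x (e i)‖ := Finset.sum_nonneg fun i _ => norm_nonneg _
    positivity
  gcongr
  rw [← integral_const_mul]
  refine integral_mono (core_int μ hS (cH.pow 2)) ((core_int μ hS (cont_FF e hu)).const_mul _)
    fun x => ?_
  unfold FF
  refine core_H (by positivity) ?_ (Finset.sum_nonneg fun i _ => by positivity)
  simpa using sq_sum_le_card_mul_sum_sq (s := Finset.univ) (f := fun i => ‖fderiv ℝ u x (e i)‖)

lemma core_main (hD : 3 ≤ Module.finrank ℝ E) (hL : ∀ L : E →L[ℝ] ℂ, ‖L‖ ≤ ∑ i, ‖L (e i)‖)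
    {K : ℝ} (hK0 : 0 ≤ K) : ∃ C : ℝ, 0 ≤ C ∧ ∀ u : E → ℂ, ContDiff ℝ 2 u → ∀ η : E → ℝ,
      ContDiff ℝ 1 η → HasCompactSupport η → (∀ x, 0 ≤ η x) → (∀ x, η x ≤ 1) →
      (∀ x i, |fderiv ℝ η x (e i)| ≤ K) →
      ∫ x in tsupport η, (η x ^ 2 * (1 + ‖u x‖^2) ^ (2 / (Module.finrank ℝ E : ℝ)) * ‖u x‖)^2 ∂μ
      ≤ (1 + C * (∫ x in tsupport η, ‖u x‖^2 ∂μ) ^ (2 / (Module.finrank ℝ E : ℝ)))^2 *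
        ∫ x in tsupport η, FF e u x ∂μ := by
  obtain ⟨Cs, hCs, hsob⟩ := core_sob μ hD
  set D := Module.finrank ℝ E
  have hD' : (3:ℝ) ≤ D := by exact_mod_cast hD
  have hD2 : (0:ℝ) < D - 2 := by linarith
  set CH : ℝ := 192 + 3072 * K^2 * Fintype.card ι + 192 * (Fintype.card ι : ℝ)^2 * K^4 with hCH
  have hCH0 : 0 ≤ CH := by positivity
  refine ⟨Cs * Fintype.card ι * √CH, by positivity, fun u hu η hη hc h0 h1 hK => ?_⟩
  set a : ℝ := 2 / D with ha_def
  have ha : 0 ≤ a := by positivity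
  have ha1 : a ≤ 1 := by rw [ha_def, div_le_one (by linarith)]; linarith
  have hgrad := core_grad μ e ha ha1 hu hη hc h0 h1 hK0 hK
  rw [← hCH] at hgrad
  have hS : IsCompact (tsupport η) := hc
  have hs : ∀ x, 1 + ‖u x‖^2 ≠ 0 := fun x => by positivity
  have hu1 : ContDiff ℝ 1 u := hu.of_le (by norm_num)
  have hρ : ∀ b : ℝ, ContDiff ℝ 1 (fun x => (1 + ‖u x‖^2) ^ b) := fun b =>
    (contDiff_const.add (hu1.norm_sq ℝ)).rpow_const_of_ne hs
  have hV : ContDiff ℝ 1 (fun x => (η x ^ 2 * (1 + ‖u x‖^2) ^ (a/2)) • u x) :=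
    ((hη.pow 2).mul (hρ _)).smul hu1
  set v : E → ℂ := fun x => (η x ^ 2 * (1 + ‖u x‖^2) ^ (a/2)) • u x with hv
  have hvs : Function.support v ⊆ Function.support η := fun x hx h => by
    simp only [Function.mem_support, hv] at hx
    exact hx (by rw [h]; simp)
  have hvc : HasCompactSupport v := hc.mono hvs
  have hsv := hsob v hV hvc
  set Y := ∫ x in tsupport η, (η x ^ 2 * (1 + ‖u x‖^2) ^ a * ‖u x‖)^2 ∂μ with hY
  set I := ∫ x in tsupport η, FF e u x ∂μ with hI
  set M := ∫ x in tsupport η, ‖u x‖^2 ∂μ with hM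
  have hY0 : 0 ≤ Y := integral_nonneg fun x => by positivity
  have hFF0 : ∀ x, 0 ≤ FF e u x := fun x => by unfold FF; positivity
  have hI0 : 0 ≤ I := integral_nonneg hFF0
  have hM0 : 0 ≤ M := integral_nonneg fun x => by positivity
  have cu := hu.continuous
  have cη := hη.continuous
  have cρ := (hρ a).continuous
  have cv := hV.continuous
  -- gradient of `v`
  have hG : ∫ x, ‖fderiv ℝ v x‖^2 ∂μ ≤ Fintype.card ι * (√Y * √(CH * I)) := by
    rw [← setIntegral_eq_integral_of_forall_compl_eq_zero (s := tsupport η)]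
    · refine le_trans ?_ (mul_le_mul_of_nonneg_left hgrad (by positivity))
      rw [← integral_const_mul]
      refine integral_mono (core_int μ hS ((hV.continuous_fderiv (by norm_num)).norm.pow 2))
        ((core_int μ hS (continuous_finsetSum _ fun i _ =>
          (cont_d hV (e i)).norm.pow 2)).const_mul _) fun x => ?_
      refine (pow_le_pow_left₀ (norm_nonneg _) (hL (fderiv ℝ v x)) 2).trans ?_
      simpa using sq_sum_le_card_mul_sum_sq (s := Finset.univ)
        (f := fun i => ‖fderiv ℝ v x (e i)‖)
    · intro x hx
      have : fderiv ℝ v x = 0 := by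
        by_contra h
        exact hx (closure_mono hvs (support_fderiv_subset ℝ h))
      rw [this]; simp
  have hv2 : ∀ x, ‖v x‖^2 = η x ^ 4 * (1 + ‖u x‖^2) ^ a * ‖u x‖^2 := fun x => by
    have hη0 := h0 x
    have hp : 0 ≤ 1 + ‖u x‖^2 := by positivity
    rw [hv]
    simp only [norm_smul, mul_pow, Real.norm_eq_abs]
    rw [sq_abs, mul_pow, ← Real.rpow_mul_natCast hp]
    norm_num
    ring_nf
    simp
  -- first piece
  have hp1 : ∫ x in tsupport η, ‖v x‖^2 ∂μ ≤ √Y * √I := by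
    have cf : Continuous (fun x => η x ^ 2 * (1 + ‖u x‖^2) ^ a * ‖u x‖) :=
      ((cη.pow 2).mul cρ).mul cu.norm
    have ch : Continuous (fun x => η x ^ 2 * ‖u x‖) := by fun_prop
    have := core_cs μ hS cf ch (fun x => by have := h0 x; positivity) (fun x => by positivity)
    refine le_trans (le_of_eq ?_) (this.trans ?_)
    · refine integral_congr_ae (Eventually.of_forall fun x => ?_)
      simp only [hv2]; ring
    · gcongr
      refine integral_mono (core_int μ hS (ch.pow 2)) (core_int μ hS (cont_FF e hu)) fun x => ?_
      have e1 : η x ^ 2 ≤ 1 := pow_le_one₀ (h0 x) (h1 x)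
      have e2 : η x ^ 2 * ‖u x‖ ≤ ‖u x‖ := mul_le_of_le_one_left (norm_nonneg _) e1
      have e3 := pow_le_pow_left₀ (by positivity) e2 2
      refine e3.trans ?_
      have : 0 ≤ ∑ i, ‖fderiv ℝ u x (e i)‖^2 := Finset.sum_nonneg fun i _ => by positivity
      unfold FF
      nlinarith [sq_nonneg ‖∑ i, fderiv ℝ (fun y => fderiv ℝ u y (e i)) x (e i)‖]
  -- second piece
  have cua : Continuous (fun x => ‖u x‖ ^ (2 * a)) := cu.norm.rpow_const fun x => Or.inr (by positivity)
  have hp2 : ∫ x in tsupport η, ‖v x‖^2 * ‖u x‖ ^ (2 * a) ∂μ ≤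
      Cs * (Fintype.card ι * (√Y * √(CH * I))) * M ^ a := by
    have hpq : Real.HolderConjugate ((D:ℝ) / (D - 2)) (D / 2) :=
      ⟨by field_simp; ring, by positivity, by positivity⟩
    have := integral_mul_le_Lp_mul_Lq_of_nonneg (μ := μ.restrict (tsupport η)) hpq
      (f := fun x => ‖v x‖^2) (g := fun x => ‖u x‖ ^ (2 * a))
      (Eventually.of_forall fun x => by positivity) (Eventually.of_forall fun x => by positivity)
      (core_memLp μ hS (cv.norm.pow 2) _) (core_memLp μ hS cua _)
    refine this.trans ?_
    have e1 : ∀ x, (‖u x‖ ^ (2 * a)) ^ ((D:ℝ)/2) = ‖u x‖^2 := fun x => by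
      rw [← Real.rpow_mul (norm_nonneg _), ← Real.rpow_two]
      congr 1
      rw [ha_def]; field_simp
    have e2 : ∀ x, (‖v x‖ ^ 2) ^ ((D:ℝ)/(D-2)) = ‖v x‖ ^ (2 * (D:ℝ) / (D - 2)) := fun x => by
      rw [← Real.rpow_two, ← Real.rpow_mul (norm_nonneg _)]
      congr 1
      ring
    simp only [e1, e2]
    rw [← hM, one_div_div, one_div_div, ← ha_def]
    gcongr
    rw [setIntegral_eq_integral_of_forall_compl_eq_zero]
    · exact hsv.trans (by gcongr)
    · intro x hx
      have : v x = 0 := by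
        by_contra h
        exact hx (subset_closure (hvs h))
      rw [this, norm_zero, Real.zero_rpow (by positivity)]
  have hYle : Y ≤ √Y * √I + Cs * (Fintype.card ι * (√Y * √(CH * I))) * M ^ a := by
    refine le_trans ?_ (add_le_add hp1 hp2)
    have i1 : Integrable (fun x => ‖v x‖^2) (μ.restrict (tsupport η)) :=
      core_int μ hS (cv.norm.pow 2)
    have i2 : Integrable (fun x => ‖v x‖^2 * ‖u x‖ ^ (2 * a)) (μ.restrict (tsupport η)) :=
      core_int μ hS ((cv.norm.pow 2).mul cua)
    rw [← integral_add i1 i2, hY]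
    refine integral_mono (core_int μ hS ((((cη.pow 2).mul cρ).mul cu.norm).pow 2))
      (i1.add i2) fun x => ?_
    have hsub : (1 + ‖u x‖^2) ^ a ≤ 1 + ‖u x‖ ^ (2 * a) := by
      refine (Real.rpow_add_le_add_rpow zero_le_one (sq_nonneg _) ha ha1).trans (le_of_eq ?_)
      rw [Real.one_rpow, ← Real.rpow_two, ← Real.rpow_mul (norm_nonneg _)]
    simp only [Pi.add_apply]
    calc (η x ^ 2 * (1 + ‖u x‖^2) ^ a * ‖u x‖)^2 = ‖v x‖^2 * (1 + ‖u x‖^2) ^ a := by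
          rw [hv2]; ring
      _ ≤ ‖v x‖^2 * (1 + ‖u x‖ ^ (2 * a)) := by gcongr
      _ = _ := by ring
  rw [Real.sqrt_mul hCH0] at hYle
  have hfac : √Y * √Y ≤ √Y * (√I * (1 + Cs * Fintype.card ι * √CH * M ^ a)) := by
    rw [Real.mul_self_sqrt hY0]; refine hYle.trans (le_of_eq (by ring))
  have hMa : 0 ≤ M ^ a := by positivity
  have hb : √Y ≤ √I * (1 + Cs * Fintype.card ι * √CH * M ^ a) := by
    rcases (Real.sqrt_nonneg Y).eq_or_lt with h | h
    · rw [← h]; positivity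
    · exact le_of_mul_le_mul_left hfac h
  have := pow_le_pow_left₀ (Real.sqrt_nonneg _) hb 2
  rw [Real.sq_sqrt hY0, mul_pow, Real.sq_sqrt hI0] at this
  linarith

end core3
end BNLS

namespace BNLS

/-- The standard coordinate vectors of `ℝ^d × ℝ^n`. -/
def eV (d n : ℕ) : Fin d ⊕ Fin n → Pt d n :=
  Sum.elim (fun i => (Pi.single i 1, 0)) (fun j => (0, Pi.single j 1))

lemma eV_norm (d n : ℕ) (i : Fin d ⊕ Fin n) : ‖eV d n i‖ ≤ 1 := by
  rcases i with i | j
  · simp only [eV, Sum.elim_inl, Prod.norm_mk, norm_zero, Pi.norm_single, norm_one]; simp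
  · simp only [eV, Sum.elim_inr, Prod.norm_mk, norm_zero, Pi.norm_single, norm_one]; simp

lemma eV_bound (d n : ℕ) (L : Pt d n →L[ℝ] ℂ) : ‖L‖ ≤ ∑ i, ‖L (eV d n i)‖ := by
  refine L.opNorm_le_bound (Finset.sum_nonneg fun i _ => norm_nonneg _) fun p => ?_
  have hp : p = ∑ i, (Sum.elim p.1 p.2 i : ℝ) • eV d n i := by
    rw [Fintype.sum_sum_type]
    simp only [Sum.elim_inl, Sum.elim_inr, eV]
    ext k
    · simp [Prod.fst_sum, Finset.sum_apply, Pi.single_apply]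
    · simp [Prod.snd_sum, Finset.sum_apply, Pi.single_apply]
  conv_lhs => rw [hp]
  rw [map_sum, Finset.sum_mul]
  refine (norm_sum_le _ _).trans (Finset.sum_le_sum fun i _ => ?_)
  rw [map_smul, norm_smul, mul_comm]
  gcongr
  rcases i with i | j
  · exact (norm_le_pi_norm p.1 i).trans (norm_fst_le p)
  · exact (norm_le_pi_norm p.2 j).trans (norm_snd_le p)

lemma FF_eq (d n : ℕ) (u : Pt d n → ℂ) (z : Pt d n) : FF (eV d n) u z =
    ‖u z‖^2 + ((∑ i, ‖dX d n i u z‖^2) + ∑ j, ‖dY d n j u z‖^2) + ‖lap d n u z‖^2 := by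
  unfold FF
  rw [Fintype.sum_sum_type, Fintype.sum_sum_type]
  rfl

lemma μP_eq (d n : ℕ) : μP d n = (volume : Measure (Pt d n)).restrict (univ ×ˢ torusBox n) := by
  unfold μP μT
  rw [Measure.volume_eq_prod, ← Measure.prod_restrict, Measure.restrict_univ]

instance haarPt (d n : ℕ) : (volume : Measure (Pt d n)).IsAddHaarMeasure := by
  have h1 : (volume : Measure (Fin d → ℝ)).IsAddHaarMeasure := inferInstance
  have h2 : (volume : Measure (Fin n → ℝ)).IsAddHaarMeasure := inferInstance
  exact Measure.prod.instIsAddHaarMeasure (volume : Measure (Fin d → ℝ)) (volume : Measure (Fin n → ℝ))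

lemma torusBox_meas (n : ℕ) : MeasurableSet (torusBox n) :=
  MeasurableSet.univ_pi fun _ => measurableSet_Ico

lemma cutoff (d n : ℕ) : ∃ K : ℝ, 0 ≤ K ∧ ∀ R : ℝ, 1 ≤ R → ∃ η : Pt d n → ℝ,
    ContDiff ℝ 1 η ∧ HasCompactSupport η ∧ (∀ x, 0 ≤ η x) ∧ (∀ x, η x ≤ 1) ∧
    (∀ x i, |fderiv ℝ η x (eV d n i)| ≤ K) ∧
    (∀ p : Pt d n, ‖p.1‖ ≤ R → p.2 ∈ torusBox n → η p = 1) ∧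
    (∀ p ∈ tsupport η, ∀ j, -(2*π) ≤ p.2 j ∧ p.2 j < 4*π) := by
  let cc : Pt d n := (0, fun _ => π)
  let g : ContDiffBump cc := ⟨4, 5, by norm_num, by norm_num⟩
  have hg : ContDiff ℝ 1 g := g.contDiff
  have hgc : HasCompactSupport g := g.hasCompactSupport
  obtain ⟨K, hK⟩ := (hgc.fderiv ℝ).exists_bound_of_continuous (hg.continuous_fderiv (by norm_num))
  have hK0 : 0 ≤ K := (norm_nonneg _).trans (hK 0)
  refine ⟨K, hK0, fun R hR => ?_⟩
  have hR0 : 0 < R := by linarith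
  let A : Pt d n →L[ℝ] Pt d n :=
    (R⁻¹ • ContinuousLinearMap.fst ℝ _ _).prod (ContinuousLinearMap.snd ℝ _ _)
  have hA : ∀ p : Pt d n, A p = (R⁻¹ • p.1, p.2) := fun p => rfl
  have hRi : R⁻¹ ≤ 1 := inv_le_one_of_one_le₀ hR
  have hAn : ∀ p : Pt d n, ‖A p‖ ≤ ‖p‖ := fun p => by
    rw [hA, Prod.norm_def, Prod.norm_def]
    refine max_le_max ?_ le_rfl
    simp only [norm_smul, norm_inv, Real.norm_eq_abs, abs_of_pos hR0]
    exact mul_le_of_le_one_left (norm_nonneg _) hRi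
  have hsub : Function.support (fun p => g (A p)) ⊆
      Metric.closedBall (0 : Fin d → ℝ) (5 * R) ×ˢ Metric.closedBall (fun _ : Fin n => π) 5 := by
    intro p hp
    have h1 : A p ∈ Metric.ball cc 5 := by
      have : A p ∈ Function.support g := hp
      rwa [g.support_eq] at this
    rw [Metric.mem_ball, hA, Prod.dist_eq, max_lt_iff] at h1
    refine ⟨?_, Metric.mem_closedBall.2 h1.2.le⟩
    rw [mem_closedBall_zero_iff]
    have h2 := h1.1
    simp only [cc, dist_zero_right, norm_smul, norm_inv, Real.norm_eq_abs, abs_of_pos hR0] at h2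
    rw [inv_mul_lt_iff₀ hR0] at h2
    linarith
  have hcomp : IsCompact (Metric.closedBall (0 : Fin d → ℝ) (5 * R) ×ˢ
      Metric.closedBall (fun _ : Fin n => π) 5) :=
    (isCompact_closedBall _ _).prod (isCompact_closedBall _ _)
  refine ⟨fun p => g (A p), hg.comp A.contDiff,
    HasCompactSupport.of_support_subset_isCompact hcomp hsub,
    fun x => g.nonneg, fun x => g.le_one, fun x i => ?_, fun p hp hp2 => ?_, fun p hp j => ?_⟩
  · have : fderiv ℝ (fun p => g (A p)) x = (fderiv ℝ g (A x)).comp A := by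
      have := fderiv_comp (𝕜 := ℝ) x (hg.differentiable (by norm_num) (A x)) A.differentiableAt
      rw [A.fderiv] at this
      exact this
    rw [this, ContinuousLinearMap.comp_apply, ← Real.norm_eq_abs]
    refine ((fderiv ℝ g (A x)).le_opNorm _).trans ?_
    calc _ ≤ K * 1 := by
          gcongr
          · exact hK _
          · exact (hAn _).trans (eV_norm d n i)
      _ = K := mul_one K
  · apply g.one_of_mem_closedBall
    rw [Metric.mem_closedBall, hA, Prod.dist_eq, max_le_iff]
    constructor
    · simp only [cc, dist_zero_right, norm_smul, norm_inv, Real.norm_eq_abs, abs_of_pos hR0]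
      rw [inv_mul_le_iff₀ hR0]
      change _ ≤ R * 4
      nlinarith
    · refine (dist_pi_le_iff (by norm_num [g])).2 fun j => ?_
      have := hp2 j (mem_univ j)
      simp only [cc, Real.dist_eq]
      rw [abs_le]
      have h4 := Real.pi_lt_four
      change -4 ≤ _ ∧ _ ≤ (4:ℝ)
      constructor <;> linarith [this.1, this.2]
  · have h := closure_minimal hsub hcomp.isClosed hp
    have h1 := (dist_le_pi_dist p.2 (fun _ => π) j).trans (Metric.mem_closedBall.1 h.2)
    rw [Real.dist_eq, abs_le] at h1
    have h3 := Real.pi_gt_three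
    constructor <;> linarith [h1.1, h1.2]

lemma rpow_interp {α γ δ : ℝ} (hα : 0 < α) (hαγ : α < γ) (hδ : 0 < δ) :
    ∃ C : ℝ, 0 ≤ C ∧ ∀ t : ℝ, 0 ≤ t → t ^ α ≤ δ * t ^ γ + C := by
  set T := δ ^ (-(1/(γ-α))) with hT
  have hT0 : 0 < T := by positivity
  have hγα : 0 < γ - α := by linarith
  refine ⟨T ^ α, by positivity, fun t ht => ?_⟩
  rcases le_total t T with h | h
  · have : t ^ α ≤ T ^ α := by gcongr
    have : 0 ≤ δ * t ^ γ := by positivity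
    linarith
  · have ht0 : 0 < t := hT0.trans_le h
    have h1 : t ^ α = t ^ (α - γ) * t ^ γ := by rw [← Real.rpow_add ht0]; ring_nf
    have h2 : t ^ (α - γ) ≤ T ^ (α - γ) :=
      Real.rpow_le_rpow_of_nonpos hT0 h (by linarith)
    have h3 : T ^ (α - γ) = δ := by
      rw [hT, ← Real.rpow_mul hδ.le]
      have : -(1/(γ-α)) * (α - γ) = 1 := by field_simp; ring
      rw [this, Real.rpow_one]
    rw [h1]
    have : t ^ (α - γ) * t ^ γ ≤ δ * t ^ γ := by rw [← h3]; gcongr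
    have : 0 ≤ T ^ α := by positivity
    linarith

lemma shift_of_periodic {d n : ℕ} {u : Pt d n → ℂ} (hu : Periodic d n u) (k : Fin n → ℤ)
    (p : Pt d n) : u (p + (0, fun j => 2 * π * k j)) = u p := by
  let H : AddSubgroup (Fin n → ℝ) :=
    { carrier := {w | ∀ p : Pt d n, u (p + (0, w)) = u p}
      zero_mem' := fun p => by
        congr 1
        ext <;> simp
      add_mem' := fun {a b} ha hb p => by
        have h := hb (p + (0, a))
        rw [ha p] at h
        rw [← h]
        congr 1
        ext <;> simp [add_assoc]
      neg_mem' := fun {a} ha p => by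
        have h := ha (p + (0, -a))
        rw [← h]
        congr 1
        ext <;> simp }
  have hs : ∀ j, (2 * π) • (Pi.single j 1 : Fin n → ℝ) ∈ H := fun j p => by
    rw [← hu j p]
    congr 1
    ext <;> simp
  have : (fun j => 2 * π * (k j : ℝ)) = ∑ j, k j • ((2 * π) • (Pi.single j 1 : Fin n → ℝ)) := by
    ext i
    simp [Finset.sum_apply, Pi.single_apply, mul_comm]
  have hm : (fun j => 2 * π * (k j : ℝ)) ∈ H := by
    rw [this]
    exact sum_mem fun j _ => H.zsmul_mem (hs j) _
  exact hm p

lemma fderiv_shift {d n : ℕ} {u : Pt d n → ℂ} {w : Pt d n} (h : ∀ p, u (p + w) = u p)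
    (p : Pt d n) : fderiv ℝ u (p + w) = fderiv ℝ u p := by
  rw [← fderiv_comp_add_right (𝕜 := ℝ) (f := u) w]
  congr 1
  exact funext h

lemma FF_shift {d n : ℕ} {u : Pt d n → ℂ} {w : Pt d n} (h : ∀ p, u (p + w) = u p)
    (p : Pt d n) : FF (eV d n) u (p + w) = FF (eV d n) u p := by
  unfold FF
  have h2 : ∀ i p, (fun y => fderiv ℝ u y (eV d n i)) (p + w)
      = (fun y => fderiv ℝ u y (eV d n i)) p := fun i p => by
    simp only [fderiv_shift h]
  rw [h p, fderiv_shift h p]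
  have h3 : ∀ i, fderiv ℝ (fun y => fderiv ℝ u y (eV d n i)) (p + w)
      = fderiv ℝ (fun y => fderiv ℝ u y (eV d n i)) p := fun i =>
    fderiv_shift (u := fun y => fderiv ℝ u y (eV d n i)) (h2 i) p
  simp only [h3]

lemma cover_int {d n : ℕ} {f : Pt d n → ℝ} (hf0 : ∀ p, 0 ≤ f p) (hfc : Continuous f)
    (hper : ∀ (k : Fin n → ℤ) p, f (p + (0, fun j => 2 * π * k j)) = f p)
    (hfi : Integrable f (μP d n)) {S : Set (Pt d n)}
    (hS : ∀ p ∈ S, ∀ j, -(2*π) ≤ p.2 j ∧ p.2 j < 4*π) :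
    ∫ p in S, f p ≤ 3 ^ n * ∫ p, f p ∂(μP d n) := by
  have key : ∫⁻ p in S, ENNReal.ofReal (f p) ≤
      (3 ^ n : ENNReal) * ∫⁻ p, ENNReal.ofReal (f p) ∂(μP d n) := by
    let sh : (Fin n → Fin 3) → Pt d n := fun k => (0, fun j => 2 * π * ((1 - (k j : ℤ) : ℤ) : ℝ))
    let T : (Fin n → Fin 3) → Set (Pt d n) := fun k => (fun p => p + sh k) ⁻¹' (univ ×ˢ torusBox n)
    have hST : S ⊆ ⋃ k, T k := by
      intro p hp
      have : ∀ j, ∃ k : Fin 3, p.2 j + 2 * π * ((1 - (k : ℤ) : ℤ) : ℝ) ∈ Ico 0 (2*π) := by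
        intro j
        obtain ⟨h1, h2⟩ := hS p hp j
        have hpi := Real.pi_pos
        by_cases c1 : p.2 j < 0
        · refine ⟨0, ?_⟩
          simp only [mem_Ico]; norm_num; constructor <;> linarith
        · by_cases c2 : p.2 j < 2 * π
          · refine ⟨1, ?_⟩
            simp only [mem_Ico]; norm_num; constructor <;> linarith
          · refine ⟨2, ?_⟩
            simp only [mem_Ico]; norm_num; constructor <;> linarith
      choose k hk using this
      refine mem_iUnion.2 ⟨k, mem_univ _, fun j _ => hk j⟩
    calc ∫⁻ p in S, ENNReal.ofReal (f p) ≤ ∫⁻ p in ⋃ k, T k, ENNReal.ofReal (f p) :=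
          lintegral_mono_set hST
      _ ≤ ∑' k, ∫⁻ p in T k, ENNReal.ofReal (f p) := lintegral_iUnion_le _ _
      _ = ∑ k, ∫⁻ p in T k, ENNReal.ofReal (f p) := tsum_fintype _
      _ = ∑ k : Fin n → Fin 3, ∫⁻ p, ENNReal.ofReal (f p) ∂(μP d n) := by
          refine Finset.sum_congr rfl fun k _ => ?_
          have mp := measurePreserving_add_right (volume : Measure (Pt d n)) (sh k)
          have := mp.setLIntegral_comp_preimage (s := univ ×ˢ torusBox n)
            (MeasurableSet.univ.prod (torusBox_meas n))
            (f := fun p => ENNReal.ofReal (f p)) (by fun_prop)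
          rw [μP_eq, ← this]
          refine lintegral_congr fun p => ?_
          rw [hper]
      _ = _ := by simp
  have hi0 : 0 ≤ ∫ p, f p ∂(μP d n) := integral_nonneg hf0
  rw [← ofReal_integral_eq_lintegral_ofReal hfi (Eventually.of_forall hf0)] at key
  have hfin : ∫⁻ p in S, ENNReal.ofReal (f p) ≠ ⊤ := by
    refine (key.trans_lt ?_).ne
    exact ENNReal.mul_lt_top (by simp) ENNReal.ofReal_lt_top
  rw [integral_eq_lintegral_of_nonneg_ae (Eventually.of_forall hf0) hfc.aestronglyMeasurable]
  have := ENNReal.toReal_mono (by simp [ENNReal.mul_eq_top]) key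
  simpa [ENNReal.toReal_mul, ENNReal.toReal_ofReal hi0] using this

end BNLS

namespace BNLS

lemma grad_cont {d n : ℕ} {u : Pt d n → ℂ} (hu : ContDiff ℝ 2 u) :
    (∀ i, Continuous (dX d n i u)) ∧ (∀ j, Continuous (dY d n j u)) :=
  ⟨fun i => (contDiff_d hu _).continuous, fun j => (contDiff_d hu _).continuous⟩

lemma lap_cont {d n : ℕ} {u : Pt d n → ℂ} (hu : ContDiff ℝ 2 u) : Continuous (lap d n u) := by
  have h1 : ∀ i, Continuous (dX d n i (dX d n i u)) := fun i => cont_d (contDiff_d hu _) _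
  have h2 : ∀ j, Continuous (dY d n j (dY d n j u)) := fun i => cont_d (contDiff_d hu _) _
  unfold lap lapX lapY
  fun_prop

lemma lap_int {d n : ℕ} {u : Pt d n → ℂ} (hu : InH2 d n u) :
    Integrable (fun z => ‖lap d n u z‖^2) (μP d n) := by
  obtain ⟨hc, -, -, -, hh⟩ := hu
  refine (hh.const_mul ((d:ℝ) + n)).mono' ((lap_cont hc).norm.pow 2).aestronglyMeasurable
    (Eventually.of_forall fun z => ?_)
  rw [Real.norm_eq_abs, abs_of_nonneg (by positivity)]
  have h1 : lap d n u z = ∑ s : Fin d ⊕ Fin n,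
      Sum.elim (fun i => dX d n i (dX d n i u) z) (fun j => dY d n j (dY d n j u) z) s := by
    rw [Fintype.sum_sum_type]; rfl
  have h2 : ‖lap d n u z‖ ≤ ∑ s : Fin d ⊕ Fin n,
      ‖Sum.elim (fun i => dX d n i (dX d n i u) z) (fun j => dY d n j (dY d n j u) z) s‖ := by
    rw [h1]; exact norm_sum_le _ _
  have h3 := (pow_le_pow_left₀ (norm_nonneg _) h2 2).trans sq_sum_le_card_mul_sum_sq
  rw [Finset.card_univ, Fintype.card_sum, Fintype.card_fin, Fintype.card_fin,
    Fintype.sum_sum_type] at h3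
  simp only [Sum.elim_inl, Sum.elim_inr] at h3
  refine h3.trans ?_
  push_cast
  gcongr
  unfold hessInt
  have a1 : ∑ i, ‖dX d n i (dX d n i u) z‖^2 ≤ ∑ i, ∑ i', ‖dX d n i (dX d n i' u) z‖^2 :=
    Finset.sum_le_sum fun i _ => Finset.single_le_sum
      (f := fun i' => ‖dX d n i (dX d n i' u) z‖^2) (fun _ _ => by positivity) (Finset.mem_univ i)
  have a2 : ∑ j, ‖dY d n j (dY d n j u) z‖^2 ≤ ∑ j, ∑ j', ‖dY d n j (dY d n j' u) z‖^2 :=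
    Finset.sum_le_sum fun i _ => Finset.single_le_sum
      (f := fun i' => ‖dY d n i (dY d n i' u) z‖^2) (fun _ _ => by positivity) (Finset.mem_univ i)
  have a3 : 0 ≤ ∑ i, ∑ j, ‖dY d n j (dX d n i u) z‖^2 := by positivity
  have a4 : 0 ≤ ∑ j, ∑ i, ‖dX d n i (dY d n j u) z‖^2 := by positivity
  linarith

lemma gradX_int {d n : ℕ} {u : Pt d n → ℂ} (hu : InH2 d n u) :
    Integrable (fun z => ∑ i, ‖dX d n i u z‖^2) (μP d n) := by
  obtain ⟨hc, -, -, hg, -⟩ := hu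
  have h1 := (grad_cont hc).1
  refine hg.mono' (Continuous.aestronglyMeasurable (by fun_prop)) (Eventually.of_forall fun z => ?_)
  rw [Real.norm_eq_abs, abs_of_nonneg (by positivity)]
  have : 0 ≤ ∑ j, ‖dY d n j u z‖^2 := by positivity
  linarith

lemma gradY_int {d n : ℕ} {u : Pt d n → ℂ} (hu : InH2 d n u) :
    Integrable (fun z => ∑ j, ‖dY d n j u z‖^2) (μP d n) := by
  obtain ⟨hc, -, -, hg, -⟩ := hu
  have h1 := (grad_cont hc).2
  refine hg.mono' (Continuous.aestronglyMeasurable (by fun_prop)) (Eventually.of_forall fun z => ?_)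
  rw [Real.norm_eq_abs, abs_of_nonneg (by positivity)]
  have : 0 ≤ ∑ j, ‖dX d n j u z‖^2 := by positivity
  linarith

lemma FF_int {d n : ℕ} {u : Pt d n → ℂ} (hu : InH2 d n u) :
    Integrable (FF (eV d n) u) (μP d n) ∧
    ∫ z, FF (eV d n) u z ∂(μP d n) = Mass d n u + gradSq d n u + lapSq d n u := by
  have h : FF (eV d n) u = fun z => ‖u z‖^2 +
      ((∑ i, ‖dX d n i u z‖^2) + ∑ j, ‖dY d n j u z‖^2) + ‖lap d n u z‖^2 :=
    funext fun z => FF_eq d n u z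
  have i1 := hu.2.2.1
  have i2 := gradX_int hu
  have i3 := gradY_int hu
  have i4 := lap_int hu
  rw [h]
  refine ⟨(i1.add (i2.add i3)).add i4, ?_⟩
  have e1 := integral_add (i1.add (i2.add i3)) i4
  have e2 := integral_add i1 (i2.add i3)
  have e3 := integral_add i2 i3
  simp only [Pi.add_apply] at e1 e2 e3
  rw [e1, e2, e3]
  rfl

lemma GN (d n : ℕ) (hdn : 3 ≤ d + n) (τ : ℝ) (hτ : 0 ≤ τ) {α : ℝ} (hα : 0 < α)
    (hα' : α < 8 / ((d:ℝ) + n)) {ε : ℝ} (hε : 0 < ε) : ∃ C : ℝ, ∀ u ∈ Sset d n τ,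
    Npow d n (α+2) u ≤ ε * (gradSq d n u + lapSq d n u) + C := by
  obtain ⟨K, hK0, hcut⟩ := cutoff d n
  have hfr : Module.finrank ℝ (Pt d n) = d + n := by simp
  obtain ⟨C, hC0, hcore⟩ := core_main (volume : Measure (Pt d n)) (eV d n) (by rw [hfr]; exact hdn)
    (eV_bound d n) hK0
  rw [hfr] at hcore
  push_cast at hcore
  have hD0 : 0 < (d:ℝ) + n := by exact_mod_cast (by omega : 0 < d + n)
  set D : ℝ := (d:ℝ) + n
  set κ : ℝ := (1 + C * (3 ^ n * τ) ^ (2 / D))^2 * 3 ^ n with hκ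
  have hκ0 : 0 < κ := by positivity
  obtain ⟨Cδ, hCδ, hinterp⟩ := rpow_interp hα hα' (δ := ε / κ) (by positivity)
  refine ⟨ε * τ + Cδ * τ, fun u hu => ?_⟩
  obtain ⟨hH, hM⟩ := hu
  obtain ⟨hFi, hFe⟩ := FF_int hH
  have hc := hH.1
  have cu := hc.continuous
  have hgrad0 : 0 ≤ gradSq d n u :=
    add_nonneg (integral_nonneg fun z => by positivity) (integral_nonneg fun z => by positivity)
  have hlap0 : 0 ≤ lapSq d n u := integral_nonneg fun z => by positivity
  by_cases hNi : Integrable (fun z => ‖u z‖ ^ (α+2)) (μP d n)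
  swap
  · unfold Npow
    rw [integral_undef hNi]
    positivity
  let φ : ℕ → Set (Pt d n) := fun k => {p | ‖p.1‖ ≤ (k:ℝ) + 1}
  have hφm : ∀ k, MeasurableSet (φ k) := fun k =>
    (isClosed_le (by fun_prop) (by fun_prop)).measurableSet
  have hφmono : Monotone φ := fun k l hkl p hp => by
    have : (k:ℝ) ≤ l := by exact_mod_cast hkl
    simp only [φ, mem_setOf_eq] at *
    linarith
  have hφU : ⋃ k, φ k = univ := by
    refine eq_univ_of_forall fun p => mem_iUnion.2 ?_
    obtain ⟨k, hk⟩ := exists_nat_ge ‖p.1‖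
    exact ⟨k, by simp only [φ, mem_setOf_eq]; linarith⟩
  have hlim := tendsto_setIntegral_of_monotone (μ := μP d n) hφm hφmono hNi.integrableOn
  rw [hφU, setIntegral_univ] at hlim
  refine le_of_tendsto hlim (Eventually.of_forall fun k => ?_)
  obtain ⟨η, hη, hηc, h0, h1, hηK, hη1, hηS⟩ := hcut ((k:ℝ) + 1) (by linarith [k.cast_nonneg (α := ℝ)])
  have hloc := hcore u hc η hη hηc h0 h1 hηK
  have hshift := fun k => shift_of_periodic (k := k) hH.2.1
  have hMS : ∫ x in tsupport η, ‖u x‖^2 ≤ 3 ^ n * τ := by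
    rw [← hM]
    exact cover_int (fun p => by positivity) (by fun_prop) (fun k p => by rw [hshift]) hH.2.2.1 hηS
  have hIS : ∫ x in tsupport η, FF (eV d n) u x ≤
      3 ^ n * (τ + gradSq d n u + lapSq d n u) := by
    rw [← hM, ← hFe]
    exact cover_int (fun p => by unfold FF; positivity) (cont_FF _ hc)
      (fun k p => FF_shift (hshift k) p) hFi hηS
  have hMS0 : 0 ≤ ∫ x in tsupport η, ‖u x‖^2 := integral_nonneg fun z => by positivity
  have hIS0 : 0 ≤ ∫ x in tsupport η, FF (eV d n) u x :=
    integral_nonneg fun z => by unfold FF; positivity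
  set Yf : Pt d n → ℝ := fun x => (η x ^ 2 * (1 + ‖u x‖^2) ^ (2 / D) * ‖u x‖)^2 with hYf
  have hYle : ∫ x in tsupport η, Yf x ≤ κ * (τ + gradSq d n u + lapSq d n u) := by
    refine hloc.trans ?_
    rw [hκ, mul_assoc]
    gcongr
  have cY : Continuous Yf := by
    have hs : ∀ x, 1 + ‖u x‖^2 ≠ 0 := fun x => by positivity
    have c1 : Continuous (fun x => (1 + ‖u x‖^2) ^ (2 / D)) :=
      Continuous.rpow_const (by fun_prop) fun x => Or.inl (hs x)
    have := hη.continuous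
    fun_prop
  have hYS : IntegrableOn Yf (tsupport η) := core_int _ hηc cY
  have hsubS : φ k ∩ univ ×ˢ torusBox n ⊆ tsupport η := fun p hp => by
    refine subset_closure ?_
    rw [Function.mem_support, hη1 p hp.1 hp.2.2]
    norm_num
  have hres : (μP d n).restrict (φ k) = volume.restrict (φ k ∩ univ ×ˢ torusBox n) := by
    rw [μP_eq, Measure.restrict_restrict (hφm k)]
  have hYi : Integrable Yf ((μP d n).restrict (φ k)) := by
    rw [hres]; exact hYS.mono_set hsubS
  have hYk : ∫ z in φ k, Yf z ∂(μP d n) ≤ κ * (τ + gradSq d n u + lapSq d n u) := by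
    refine le_trans ?_ hYle
    rw [hres]
    exact setIntegral_mono_set hYS (Eventually.of_forall fun z => by simp only [hYf]; positivity)
      hsubS.eventuallyLE
  have hMk : ∫ z in φ k, ‖u z‖^2 ∂(μP d n) ≤ τ := by
    rw [← hM]
    exact setIntegral_le_integral hH.2.2.1 (Eventually.of_forall fun z => by positivity)
  have hpt : ∫ z in φ k, ‖u z‖ ^ (α + 2) ∂(μP d n) ≤
      ∫ z in φ k, (ε / κ * Yf z + Cδ * ‖u z‖^2) ∂(μP d n) := by
    rw [hres]
    refine setIntegral_mono_on ?_ ?_ ((hφm k).inter (MeasurableSet.univ.prod (torusBox_meas n)))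
      fun z hz => ?_
    · rw [IntegrableOn, ← hres]; exact hNi.integrableOn
    · rw [IntegrableOn, ← hres]
      exact (hYi.const_mul _).add (hH.2.2.1.integrableOn.const_mul _)
    · have hη := hη1 z hz.1 hz.2.2
      have ht := norm_nonneg (u z)
      simp only [hYf, hη]
      have e1 : ‖u z‖ ^ (α + 2) = ‖u z‖ ^ α * ‖u z‖^2 := by
        rw [← Real.rpow_two, ← Real.rpow_add' ht (by linarith)]
      have e2 : ‖u z‖ ^ (8 / D) ≤ ((1 + ‖u z‖^2) ^ (2 / D))^2 := by
        rw [← Real.rpow_mul_natCast (by positivity)]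
        have : ‖u z‖ ^ (8 / D) = (‖u z‖^2) ^ (2 / D * (2:ℕ)) := by
          rw [← Real.rpow_two, ← Real.rpow_mul ht]
          congr 1
          push_cast; ring
        rw [this]
        gcongr
        linarith
      rw [e1]
      calc ‖u z‖ ^ α * ‖u z‖^2 ≤ (ε / κ * ‖u z‖ ^ (8 / D) + Cδ) * ‖u z‖^2 := by
            gcongr; exact hinterp _ ht
        _ ≤ (ε / κ * ((1 + ‖u z‖^2) ^ (2 / D))^2 + Cδ) * ‖u z‖^2 := by gcongr
        _ = _ := by ring
  refine hpt.trans ?_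
  rw [integral_add (hYi.const_mul _) (hH.2.2.1.integrableOn.const_mul _), integral_const_mul,
    integral_const_mul]
  have f1 := mul_le_mul_of_nonneg_left hYk (by positivity : 0 ≤ ε / κ)
  have f2 := mul_le_mul_of_nonneg_left hMk hCδ
  have f3 : ε / κ * (κ * (τ + gradSq d n u + lapSq d n u)) =
    ε * (τ + gradSq d n u + lapSq d n u) := by field_simp
  rw [f3] at f1
  linarith

lemma bdd (d n : ℕ) (hdn : 3 ≤ d + n) (τ : ℝ) (hτ : 0 ≤ τ) {α β : ℝ} (hα : 0 < α) (hβ : 0 < β)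
    (hα' : α < 8 / ((d:ℝ) + n)) : BddBelow (En d n β α '' Sset d n τ) := by
  obtain ⟨C, hC⟩ := GN d n hdn τ hτ hα hα' (ε := min (1/2) (β/2)) (by positivity)
  refine ⟨-C, ?_⟩
  rintro _ ⟨u, hu, rfl⟩
  have h := hC u hu
  have hN0 : 0 ≤ Npow d n (α+2) u := integral_nonneg fun z => by positivity
  have hg0 : 0 ≤ gradSq d n u :=
    add_nonneg (integral_nonneg fun z => by positivity) (integral_nonneg fun z => by positivity)
  have hl0 : 0 ≤ lapSq d n u := integral_nonneg fun z => by positivity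
  have h1 : 1 / (α + 2) * Npow d n (α+2) u ≤ Npow d n (α+2) u := by
    refine mul_le_of_le_one_left hN0 ?_
    rw [div_le_one (by linarith)]; linarith
  have h2 : min (1/2) (β/2) * gradSq d n u ≤ β/2 * gradSq d n u :=
    mul_le_mul_of_nonneg_right (min_le_right _ _) hg0
  have h3 : min (1/2) (β/2) * lapSq d n u ≤ 1/2 * lapSq d n u :=
    mul_le_mul_of_nonneg_right (min_le_left _ _) hl0
  unfold En
  linarith

end BNLS

namespace BNLS

lemma dX_smul {d n : ℕ} (i : Fin d) (s : ℝ) (u : Pt d n → ℂ) :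
    dX d n i (s • u) = s • dX d n i u := by
  funext p
  simp only [dX, fderiv_const_smul_field, Pi.smul_apply]
  rfl

lemma dY_smul {d n : ℕ} (i : Fin n) (s : ℝ) (u : Pt d n → ℂ) :
    dY d n i (s • u) = s • dY d n i u := by
  funext p
  simp only [dY, fderiv_const_smul_field, Pi.smul_apply]
  rfl

lemma nsq_smul (s : ℝ) (w : ℂ) : ‖s • w‖^2 = s^2 * ‖w‖^2 := by
  rw [norm_smul, mul_pow, Real.norm_eq_abs, sq_abs]

lemma InH2_smul {d n : ℕ} {u : Pt d n → ℂ} (s : ℝ) (hu : InH2 d n u) : InH2 d n (s • u) := by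
  obtain ⟨h1, h2, h3, h4, h5⟩ := hu
  refine ⟨h1.const_smul s, fun j p => ?_, ?_, ?_, ?_⟩
  · simp only [Pi.smul_apply, h2 j p]
  · refine (h3.const_mul (s^2)).congr (Eventually.of_forall fun z => ?_)
    simp only [Pi.smul_apply, nsq_smul]
  · refine (h4.const_mul (s^2)).congr (Eventually.of_forall fun z => ?_)
    simp only [dX_smul, dY_smul, Pi.smul_apply, nsq_smul, ← Finset.mul_sum]
    ring
  · refine (h5.const_mul (s^2)).congr (Eventually.of_forall fun z => ?_)
    simp only [hessInt, dX_smul, dY_smul, Pi.smul_apply, nsq_smul, ← Finset.mul_sum]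
    ring

lemma Mass_smul {d n : ℕ} (u : Pt d n → ℂ) (s : ℝ) :
    Mass d n (s • u) = s^2 * Mass d n u := by
  simp only [Mass, Pi.smul_apply, nsq_smul, integral_const_mul]

lemma gradSq_smul {d n : ℕ} (u : Pt d n → ℂ) (s : ℝ) :
    gradSq d n (s • u) = s^2 * gradSq d n u := by
  simp only [gradSq, gradXSq, gradYSq, dX_smul, dY_smul, Pi.smul_apply, nsq_smul,
    ← Finset.mul_sum, integral_const_mul]
  ring

lemma lapSq_smul {d n : ℕ} (u : Pt d n → ℂ) (s : ℝ) :
    lapSq d n (s • u) = s^2 * lapSq d n u := by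
  simp only [lapSq, lap, lapX, lapY, dX_smul, dY_smul, Pi.smul_apply, 
    ← Finset.smul_sum, ← smul_add, nsq_smul, integral_const_mul]

lemma Npow_smul {d n : ℕ} (u : Pt d n → ℂ) {s : ℝ} (hs : 0 ≤ s) (p : ℝ) :
    Npow d n p (s • u) = s^p * Npow d n p u := by
  have : ∀ z, ‖(s • u) z‖ ^ p = s^p * ‖u z‖^p := fun z => by
    rw [Pi.smul_apply, norm_smul, Real.norm_eq_abs, abs_of_nonneg hs,
      Real.mul_rpow hs (norm_nonneg _)]
  simp only [Npow, this, integral_const_mul]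

/-- open fundamental box -/
def oBox (n : ℕ) : Set (Fin n → ℝ) := Set.univ.pi fun _ => Set.Ioo 0 (2*π)

lemma μT_eq (n : ℕ) : μT n = volume.restrict (oBox n) := by
  unfold μT torusBox oBox
  refine Measure.restrict_congr_set ?_
  exact Measure.univ_pi_Ico_ae_eq_Icc.trans Measure.univ_pi_Ioo_ae_eq_Icc.symm

lemma mass_zero {d n : ℕ} (hd : 1 ≤ d) {u : Pt d n → ℂ} (hu : InH2 d n u)
    (hg : gradXSq d n u = 0) : Mass d n u = 0 := by
  have hc := hu.1
  have hdiff : Differentiable ℝ u := hc.differentiable (by norm_num)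
  have hoO : IsOpen (oBox n) := isOpen_set_pi finite_univ fun _ _ => isOpen_Ioo
  have hO : IsOpen ((univ : Set (Fin d → ℝ)) ×ˢ oBox n) := isOpen_univ.prod hoO
  have hμ : μP d n = volume.restrict (univ ×ˢ oBox n) := by
    unfold μP
    rw [μT_eq, Measure.volume_eq_prod, ← Measure.prod_restrict, Measure.restrict_univ]
  have h1 := (integral_eq_zero_iff_of_nonneg (fun z => by simp only [Pi.zero_apply]; positivity) (gradX_int hu)).1 hg
  rw [hμ] at h1
  have hgc := (grad_cont hc).1
  have h2 := Measure.eqOn_open_of_ae_eq h1 hO (Continuous.continuousOn (by fun_prop))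
    continuousOn_const
  have h3 : ∀ z ∈ (univ : Set (Fin d → ℝ)) ×ˢ oBox n, ∀ i, dX d n i u z = 0 := fun z hz i => by
    have := h2 hz
    simp only [Pi.zero_apply] at this
    have := (Finset.sum_eq_zero_iff_of_nonneg (fun _ _ => by positivity)).1 this i (Finset.mem_univ _)
    simpa using this
  have h4 : ∀ y ∈ oBox n, ∀ x, u (x, y) = u (0, y) := fun y hy x => by
    refine is_const_of_fderiv_eq_zero (𝕜 := ℝ) (f := fun x => u (x, y)) (by fun_prop) (fun x => ?_) x 0
    have hd1 : HasFDerivAt (fun x => u (x, y)) ((fderiv ℝ u (x, y)).comp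
        (ContinuousLinearMap.inl ℝ (Fin d → ℝ) (Fin n → ℝ))) x :=
      (hdiff (x, y)).hasFDerivAt.comp x (hasFDerivAt_prodMk_left x y)
    rw [hd1.fderiv]
    refine ContinuousLinearMap.coe_injective (LinearMap.pi_ext' fun i => LinearMap.ext_ring ?_)
    have := h3 (x, y) ⟨mem_univ _, hy⟩ i
    simpa [dX] using this
  have hi := hu.2.2.1
  unfold μP at hi
  haveI : SFinite (μT n) := by unfold μT; infer_instance
  have h5 := hi.prod_left_ae
  have hae : ∀ᵐ y ∂(μT n), y ∈ oBox n := by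
    rw [μT_eq]; exact ae_restrict_mem hoO.measurableSet
  have : Nonempty (Fin d) := ⟨⟨0, hd⟩⟩
  have hinf : ¬ IsFiniteMeasure (volume : Measure (Fin d → ℝ)) := fun h => by
    exact absurd (measure_lt_top (volume : Measure (Fin d → ℝ)) univ)
      (by rw [measure_univ_of_isAddLeftInvariant]; simp)
  unfold Mass μP
  rw [integral_prod_symm _ hi]
  refine integral_eq_zero_of_ae ?_
  filter_upwards [h5, hae] with y hy hyb
  simp only [h4 y hyb] at hy ⊢
  rw [integrable_const_iff] at hy
  rcases hy with hy | hy
  · rw [hy]; simp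
  · exact absurd hy hinf

lemma Npow_pos {d n : ℕ} (hd : 1 ≤ d) {u : Pt d n → ℂ} (hu : InH2 d n u) {β α : ℝ} (hβ : 0 < β)
    (hM : 0 < Mass d n u) (hE : En d n β α u = 0) : 0 < Npow d n (α+2) u := by
  have hN0 : 0 ≤ Npow d n (α+2) u := integral_nonneg fun z => by positivity
  refine lt_of_le_of_ne hN0 fun h => hM.ne' (mass_zero hd hu ?_)
  have hx0 : 0 ≤ gradXSq d n u := integral_nonneg fun z => by positivity
  have hy0 : 0 ≤ gradYSq d n u := integral_nonneg fun z => by positivity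
  have hl0 : 0 ≤ lapSq d n u := integral_nonneg fun z => by positivity
  unfold En gradSq at hE
  rw [← h] at hE
  refine le_antisymm ?_ hx0
  by_contra! hpos
  linarith [mul_pos hβ hpos, mul_nonneg hβ.le hy0]

end BNLS

open BNLS in
/-- if `m_b = 0` has a minimizer, then `m_τ < m_b` for every `τ > b`. -/
theorem stmt_8 (d n : ℕ) (hd : 1 ≤ d) (hn : 1 ≤ n) (β α b c : ℝ)
    (hβ : 0 < β) (hdn : n < d) (hα : 4 / (d:ℝ) ≤ α) (hα' : α < 8 / ((d:ℝ)+n))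
    (hb : 0 < b) (hbc : b < c) (hmb : mC d n β α b = 0)
    (u : Pt d n → ℂ) (hu : u ∈ Sset d n b) (hmin : En d n β α u = mC d n β α b) :
    ∀ τ : ℝ, b < τ → mC d n β α τ < mC d n β α b := by
  intro τ hτ
  have hd0 : (0:ℝ) < d := by exact_mod_cast hd
  have hα0 : 0 < α := lt_of_lt_of_le (by positivity) hα
  obtain ⟨hH, hM⟩ := hu
  rw [hmb] at hmin ⊢
  have hN := Npow_pos hd hH hβ (by rw [hM]; exact hb) hmin
  have hr : 1 < τ / b := (one_lt_div hb).2 hτ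
  set s : ℝ := Real.sqrt (τ / b) with hs
  have hs2 : s^2 = τ / b := Real.sq_sqrt (by linarith)
  have hs1 : 1 < s := by rw [hs, Real.lt_sqrt (by norm_num)]; simpa using hr
  have hmem : s • u ∈ Sset d n τ := by
    refine ⟨InH2_smul s hH, ?_⟩
    rw [Mass_smul, hM, hs2]
    field_simp
  refine lt_of_le_of_lt (csInf_le (bdd d n (by omega) τ (by linarith) hα0 hβ hα')
    ⟨_, hmem, rfl⟩) ?_
  have hpow : s^2 < s^(α+2) := by
    rw [← Real.rpow_two]
    exact Real.rpow_lt_rpow_of_exponent_lt hs1 (by linarith)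
  unfold En at hmin ⊢
  rw [lapSq_smul, gradSq_smul, Npow_smul u (by linarith)]
  have h1 : 0 < 1 / (α+2) * Npow d n (α+2) u := by positivity
  have h2 : s^2 * (1/2 * lapSq d n u + β/2 * gradSq d n u - 1/(α+2) * Npow d n (α+2) u) = 0 := by
    rw [hmin, mul_zero]
  nlinarith [mul_pos (sub_pos.2 hpow) h1]
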